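/- Write e(u) := exp(2π√(−1)·u) for u ∈ ℂ. Let c0, c1, c2, c3, c4 be complex numbers and set A := e(c0−2c1−c2), B := e(c0−2c1−c4), D := e(c0−c1), E := e(c0−2c1+c3). Define the 8×8 complex matrix Q whose columns (with respect to the standard basis e1, ..., e8) are: col 1 = e1 + e5; col 2 = e2 + e6; col 3 = e3 + e7; col 4 = e4 + e8; col 5 = (1−A)·e2 + (1−B)·e4 + (1+A)·e6 + (1+B)·e8; col 6 = (1−B)·e4 + (1+B)·e8; col 7 = (1−D)·e1 + (1+D)·e5; col 8 = (1−E)·e3 + (1+E)·e7. Then det Q = −2^4 · e(4c0 − 7c1 − c2 + c3 − c4); in particular det Q ≠ 0 and Q is invertible. -/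

import Mathlib

open Matrix Complex

theorem det_Q_aux (A B D E : ℂ) :
    (!![1, 0, 0, 0, 0,   0,   1-D, 0;
        0, 1, 0, 0, 1-A, 0,   0,   0;
        0, 0, 1, 0, 0,   0,   0,   1-E;
        0, 0, 0, 1, 1-B, 1-B, 0,   0;
        1, 0, 0, 0, 0,   0,   1+D, 0;
        0, 1, 0, 0, 1+A, 0,   0,   0;
        0, 0, 1, 0, 0,   0,   0,   1+E;
        0, 0, 0, 1, 1+B, 1+B, 0,   0] : Matrix (Fin 8) (Fin 8) ℂ).det = -2^4 * (A * B * D * E) := by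
  have h : (!![1, 0, 0, 0, 0,   0,   1-D, 0;
        0, 1, 0, 0, 1-A, 0,   0,   0;
        0, 0, 1, 0, 0,   0,   0,   1-E;
        0, 0, 0, 1, 1-B, 1-B, 0,   0;
        1, 0, 0, 0, 0,   0,   1+D, 0;
        0, 1, 0, 0, 1+A, 0,   0,   0;
        0, 0, 1, 0, 0,   0,   0,   1+E;
        0, 0, 0, 1, 1+B, 1+B, 0,   0] : Matrix (Fin 8) (Fin 8) ℂ) =
      Matrix.reindex (finSumFinEquiv (m := 4) (n := 4)) (finSumFinEquiv (m := 4) (n := 4))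
        (Matrix.fromBlocks 1
          !![0, 0, 1-D, 0; 1-A, 0, 0, 0; 0, 0, 0, 1-E; 1-B, 1-B, 0, 0] 1
          !![0, 0, 1+D, 0; 1+A, 0, 0, 0; 0, 0, 0, 1+E; 1+B, 1+B, 0, 0]) := by
    rw [← Equiv.symm_apply_eq]
    ext i j
    rcases i with i | i <;> rcases j with j | j <;> fin_cases i <;> fin_cases j <;>
      first | rfl | simp [finSumFinEquiv]
  rw [h, Matrix.det_reindex_self, Matrix.det_fromBlocks_one₁₁, Matrix.one_mul]
  simp [Matrix.det_succ_row_zero, Fin.sum_univ_succ, Fin.succAbove]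
  ring

theorem det_Q (c0 c1 c2 c3 c4 : ℂ) (A B D E : ℂ)
    (hA : A = exp (2*Real.pi*I*(c0-2*c1-c2)))
    (hB : B = exp (2*Real.pi*I*(c0-2*c1-c4)))
    (hD : D = exp (2*Real.pi*I*(c0-c1)))
    (hE : E = exp (2*Real.pi*I*(c0-2*c1+c3))) :
    (!![1, 0, 0, 0, 0,   0,   1-D, 0;
        0, 1, 0, 0, 1-A, 0,   0,   0;
        0, 0, 1, 0, 0,   0,   0,   1-E;
        0, 0, 0, 1, 1-B, 1-B, 0,   0;
        1, 0, 0, 0, 0,   0,   1+D, 0;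
        0, 1, 0, 0, 1+A, 0,   0,   0;
        0, 0, 1, 0, 0,   0,   0,   1+E;
        0, 0, 0, 1, 1+B, 1+B, 0,   0] : Matrix (Fin 8) (Fin 8) ℂ).det
      = -2^4 * exp (2*Real.pi*I*(4*c0 - 7*c1 - c2 + c3 - c4)) ∧
    (!![1, 0, 0, 0, 0,   0,   1-D, 0;
        0, 1, 0, 0, 1-A, 0,   0,   0;
        0, 0, 1, 0, 0,   0,   0,   1-E;
        0, 0, 0, 1, 1-B, 1-B, 0,   0;
        1, 0, 0, 0, 0,   0,   1+D, 0;
        0, 1, 0, 0, 1+A, 0,   0,   0;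
        0, 0, 1, 0, 0,   0,   0,   1+E;
        0, 0, 0, 1, 1+B, 1+B, 0,   0] : Matrix (Fin 8) (Fin 8) ℂ).det ≠ 0 ∧
    IsUnit (!![1, 0, 0, 0, 0,   0,   1-D, 0;
        0, 1, 0, 0, 1-A, 0,   0,   0;
        0, 0, 1, 0, 0,   0,   0,   1-E;
        0, 0, 0, 1, 1-B, 1-B, 0,   0;
        1, 0, 0, 0, 0,   0,   1+D, 0;
        0, 1, 0, 0, 1+A, 0,   0,   0;
        0, 0, 1, 0, 0,   0,   0,   1+E;
        0, 0, 0, 1, 1+B, 1+B, 0,   0] : Matrix (Fin 8) (Fin 8) ℂ) := by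
  have hd := det_Q_aux A B D E
  have he : A * B * D * E = exp (2*Real.pi*I*(4*c0 - 7*c1 - c2 + c3 - c4)) := by
    rw [hA, hB, hD, hE, ← exp_add, ← exp_add, ← exp_add]
    congr 1
    ring
  rw [he] at hd
  have hn : (-2^4 * exp (2*Real.pi*I*(4*c0 - 7*c1 - c2 + c3 - c4)) : ℂ) ≠ 0 :=
    mul_ne_zero (by norm_num) (exp_ne_zero _)
  refine ⟨hd, hd ▸ hn, ?_⟩
  rw [Matrix.isUnit_iff_isUnit_det, hd]
  exact hn.isUnit
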